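/- Let x ∈ X = Gr(n, C_{2n}[z]) and a ∈ C ∪ {∞}. The Wronskian Wr(x;z) is divisible by (z+a)^k (where divisibility by a power of (z+∞) means deg Wr(x;z) ≤ n(n+1) − k) if and only if x ∈ X_λ(a) for some partition λ ∈ Λ with |λ| = k. -/

import Mathlib

open Polynomial OnePoint

namespace OG

/-! ### Tableaux, diagrams, jeu de taquin / tableau switching -/

/-- A cell `(row, column)` (0-indexed). -/
abbrev Cell := ℕ × ℕ

/-- A filling: a finite set of (cell, entry) pairs. -/
abbrev Filling := Finset (Cell × ℕ)

def cellsOf (f : Filling) : Finset Cell := f.image Prod.fst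

def entriesOf (f : Filling) : Finset ℕ := f.image Prod.snd

/-- A (perforated/partial) standard filling: at most one entry per cell, all entries
distinct, and entries strictly increase along rows and down columns. -/
def IsPartialTableau (f : Filling) : Prop :=
  (∀ p ∈ f, ∀ q ∈ f, p.1 = q.1 → p = q) ∧
  (∀ p ∈ f, ∀ q ∈ f, p.2 = q.2 → p = q) ∧
  (∀ p ∈ f, ∀ q ∈ f, p.1.1 = q.1.1 → p.1.2 < q.1.2 → p.2 < q.2) ∧
  (∀ p ∈ f, ∀ q ∈ f, p.1.2 = q.1.2 → p.1.1 < q.1.1 → p.2 < q.2)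

/-- A standard tableau on the diagram `D` with entry set `E`. -/
def IsTableauOn (f : Filling) (D : Finset Cell) (E : Finset ℕ) : Prop :=
  IsPartialTableau f ∧ cellsOf f = D ∧ entriesOf f = E

/-- One elementary switch of the tableau switching (jeu de taquin) algorithm:
an entry `u` of the inner (sliding) family `p.2` at cell `c` is interchanged with an
entry `t` of the outer family `p.1` lying immediately east or south of `c`, provided
both families remain partial standard tableaux. -/
def SwitchStep (p q : Filling × Filling) : Prop :=
  ∃ c u d t, (c, u) ∈ p.2 ∧ (d, t) ∈ p.1 ∧
    (d = (c.1, c.2 + 1) ∨ d = (c.1 + 1, c.2)) ∧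
    q.1 = insert (c, t) (p.1.erase (d, t)) ∧
    q.2 = insert (d, u) (p.2.erase (c, u)) ∧
    IsPartialTableau q.1 ∧ IsPartialTableau q.2

/-- `Switched T U A B`: applying the tableau switching algorithm to the outer tableau `T`
and the inner tableau `U` terminates with `A` (the rectification of `T`) inside and
`B` (the new outer tableau) outside. -/
def Switched (T U A B : Filling) : Prop :=
  Relation.ReflTransGen SwitchStep (T, U) (A, B) ∧ ∀ q, ¬ SwitchStep (A, B) q

/-- `R` is the jeu de taquin rectification of the skew tableau `T` whose inner
(empty) region is the diagram `Din`. -/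
def RectifiesTo (T : Filling) (Din : Finset Cell) (R : Filling) : Prop :=
  ∃ U B, IsTableauOn U Din (Finset.Icc 1 Din.card) ∧ Switched T U R B

/-- Dual equivalence of two skew tableaux with common inner diagram `Din`:
switching with any standard tableau `U` of shape `Din` produces the same outer
tableau `Û`. -/
def DualEquiv (Din : Finset Cell) (T T' : Filling) : Prop :=
  ∀ U A A' B B', IsTableauOn U Din (Finset.Icc 1 Din.card) →
    Switched T U A B → Switched T' U A' B' → B = B'

/-- A partition `λ` with at most `n` parts, each of size at most `n+1`
(the indexing set `Λ` for the Schubert classes of `Gr(n, 2n+1)`). -/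
structure PartitionIn (n : ℕ) where
  part : ℕ → ℕ
  antitone : Antitone part
  head_le : part 0 ≤ n + 1
  vanish : ∀ i, n ≤ i → part i = 0

/-- The weight `|λ|` of a partition. -/
def wt (n : ℕ) (lam : PartitionIn n) : ℕ := ∑ i ∈ Finset.range n, lam.part i

/-- The Young diagram of a partition `λ ∈ Λ`. -/
def partDiag (n : ℕ) (lam : PartitionIn n) : Finset Cell :=
  (Finset.range n ×ˢ Finset.range (n+1)).filter fun c => c.2 < lam.part c.1

/-- The `n × (n+1)` rectangular diagram `⊞`. -/
def rectDiag (n : ℕ) : Finset Cell := Finset.range n ×ˢ Finset.range (n+1)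

/-- A standard Young tableau of rectangular shape `⊞`, with entries `1, …, n(n+1)`. -/
def IsSYTRect (n : ℕ) (T : Filling) : Prop :=
  IsTableauOn T (rectDiag n) (Finset.Icc 1 (n*(n+1)))

/-- A strict partition with all parts distinct, of size at most `n`, and at most
`n` parts (the indexing set `Σ` for Schubert classes of `OG(n, 2n+1)`). -/
structure StrictPartitionIn (n : ℕ) where
  part : ℕ → ℕ
  le_n : ∀ i, part i ≤ n
  strict : ∀ i, part i = 0 ∨ part (i+1) < part i

/-- The weight `|σ|` of a strict partition. -/
def swt (n : ℕ) (s : StrictPartitionIn n) : ℕ := ∑ i ∈ Finset.range n, s.part i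

/-- The shifted diagram of a strict partition: row `i` has `σ i` boxes starting
at column `i`. -/
def shiftedDiag (n : ℕ) (s : StrictPartitionIn n) : Finset Cell :=
  (Finset.range n ×ˢ Finset.range (2*n)).filter fun c => c.1 ≤ c.2 ∧ c.2 < c.1 + s.part c.1

/-- The staircase strict partition `δ = (n > n-1 > … > 1)`. -/
def staircase (n : ℕ) : StrictPartitionIn n where
  part i := n - i
  le_n i := Nat.sub_le n i
  strict i := by
    show n - i = 0 ∨ n - (i+1) < n - i
    omega

/-- A standard shifted tableau of staircase shape `δ`, with entries `1, …, n(n+1)/2`. -/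
def IsSSTstaircase (n : ℕ) (T : Filling) : Prop :=
  IsTableauOn T (shiftedDiag n (staircase n)) (Finset.Icc 1 (n*(n+1)/2))

/-- The partition `σ̃` associated to a strict partition `σ`:
`σ̃ⁱ = σⁱ + #{j : j ≤ i < j + σʲ}` (0-indexed). -/
def tildeFun {n : ℕ} (s : StrictPartitionIn n) (i : ℕ) : ℕ :=
  s.part i + ((Finset.range n).filter fun j => j ≤ i ∧ i < j + s.part j).card

/-- Doubling a shifted (skew) tableau `T` to a symmetrical tableau `T⋆`: an entry `k` at
shifted cell `(i,j)` produces the even entry `2k` at `(i, j+1)` and the odd entry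
`2k-1` at the transposed cell `(j, i)`. -/
def doubleFill (T : Filling) : Filling :=
  T.image (fun p => ((p.1.1, p.1.2 + 1), 2 * p.2)) ∪
  T.image (fun p => ((p.1.2, p.1.1), 2 * p.2 - 1))

/-- Deleting the odd entries of a tableau, dividing the remaining entries by `2` and
shifting each remaining cell one column to the left. -/
def halveFill (T : Filling) : Filling :=
  (T.filter fun p => 2 ∣ p.2).image fun p => ((p.1.1, p.1.2 - 1), p.2 / 2)

/-- A rectangular standard tableau is symmetrical if whenever `2k-1` occupies cell
`(i,j)`, the entry `2k` occupies cell `(j, i+1)` (0-indexed version of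
`i₂ₖ = j₂ₖ₋₁`, `j₂ₖ = i₂ₖ₋₁ + 1`). -/
def IsSymmetrical (T : Filling) : Prop :=
  ∀ i j k : ℕ, 1 ≤ k → ((i, j), 2*k - 1) ∈ T → ((j, i + 1), 2*k) ∈ T

/-- The subtableau `T_{[i,j]}` of entries lying in the interval `[i, j]`. -/
def subTab (T : Filling) (i j : ℕ) : Filling := T.filter fun p => i ≤ p.2 ∧ p.2 ≤ j

/-- The subtableau `T_{<i}`. -/
def lowTab (T : Filling) (i : ℕ) : Filling := T.filter fun p => p.2 < i

/-- The subtableau `T_{>j}`. -/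
def highTab (T : Filling) (j : ℕ) : Filling := T.filter fun p => j < p.2

/-! ### The Grassmannian, the Wronski map and the orthogonal Grassmannian -/

/-- The Wronskian of an `n`-tuple of polynomials. -/
noncomputable def wronskian (n : ℕ) (f : Fin n → ℂ[X]) : ℂ[X] :=
  (Matrix.of fun i j : Fin n => (fun p : ℂ[X] => derivative p)^[(i : ℕ)] (f j)).det

/-- `x` is a point of `X = Gr(n, C_{2n}[z])`: an `n`-dimensional subspace of the
space of polynomials of degree at most `2n`. -/
def IsGrassPt (n : ℕ) (x : Submodule ℂ ℂ[X]) : Prop :=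
  x ≤ degreeLT ℂ (2*n+1) ∧ Module.finrank ℂ x = n

/-- `Wr(x; z) = h(z)` up to a nonzero scalar: some (hence any) basis of `x` has
Wronskian a nonzero scalar multiple of `h`. -/
def WrEq (n : ℕ) (x : Submodule ℂ ℂ[X]) (h : ℂ[X]) : Prop :=
  ∃ f : Fin n → ℂ[X], Submodule.span ℂ (Set.range f) = x ∧
    ∃ c : ℂ, c ≠ 0 ∧ wronskian n f = c • h

/-- The symmetric bilinear form
`⟨Σ aₖ zᵏ/k!, Σ bₗ zˡ/l!⟩ = Σ_{m} (-1)ᵐ aₘ b_{2n-m}` on `C_{2n}[z]`. -/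
noncomputable def form (n : ℕ) (p q : ℂ[X]) : ℂ :=
  ∑ m ∈ Finset.range (2*n+1),
    (-1 : ℂ)^m * (Nat.factorial m : ℂ) * (Nat.factorial (2*n-m) : ℂ) *
      p.coeff m * q.coeff (2*n-m)

/-- `y` is a point of the orthogonal Grassmannian `Y = OG(n, C_{2n}[z])`:
an `n`-dimensional isotropic subspace. -/
def IsOGPt (n : ℕ) (y : Submodule ℂ ℂ[X]) : Prop :=
  IsGrassPt n y ∧ ∀ p ∈ y, ∀ q ∈ y, form n p q = 0

/-- The flag `F_•(a)`, for `a ∈ ℂ ∪ {∞}` (with `none` playing the role of `∞`):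
`F_i(a)` is the space of polynomials of degree at most `2n` divisible by
`(z+a)^{2n+1-i}`, and `F_i(∞) = C_{i-1}[z]`. -/
noncomputable def flag (n : ℕ) (a : Option ℂ) (i : ℕ) : Submodule ℂ ℂ[X] :=
  match a with
  | Option.none => degreeLT ℂ i
  | Option.some a0 =>
    { carrier := {p : ℂ[X] | p ∈ degreeLT ℂ (2*n+1) ∧ (X + C a0)^(2*n+1-i) ∣ p}
      add_mem' := fun hp hq => ⟨add_mem hp.1 hq.1, dvd_add hp.2 hq.2⟩
      zero_mem' := ⟨zero_mem _, dvd_zero _⟩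
      smul_mem' := by
        rintro c p ⟨h1, h2⟩
        refine ⟨Submodule.smul_mem _ _ h1, ?_⟩
        rw [Polynomial.smul_eq_C_mul]
        exact h2.mul_left _ }

/-- The Schubert variety `X_λ(a) ⊆ X` relative to the flag `F_•(a)`. -/
def SchubertX (n : ℕ) (lam : PartitionIn n) (a : Option ℂ) : Set (Submodule ℂ ℂ[X]) :=
  {x | IsGrassPt n x ∧
    ∀ i < n, i + 1 ≤ Module.finrank ℂ ↥(x ⊓ flag n a (n + 2 + i - lam.part i))}

/-- The Schubert variety `Y_σ(a) = Y ∩ X_{σ̃}(a) ⊆ Y`. -/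
def SchubertY (n : ℕ) (s : StrictPartitionIn n) (a : Option ℂ) : Set (Submodule ℂ ℂ[X]) :=
  {y | IsOGPt n y ∧
    ∀ i < n, i + 1 ≤ Module.finrank ℂ ↥(y ⊓ flag n a (n + 2 + i - tildeFun s i))}

/-! ### `ℝP¹`, fibres of the Wronski map, zones and the correspondence -/

/-- The inclusion `ℝP¹ = ℝ ∪ {∞} ↪ ℂ ∪ {∞}`. -/
def toC (t : OnePoint ℝ) : Option ℂ := Option.map (fun r : ℝ => (r : ℂ)) t

/-- The linear factor `z + a` associated to `a ∈ ℝP¹` (equal to `1` for `a = ∞`). -/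
noncomputable def linFactor (t : OnePoint ℝ) : ℂ[X] :=
  (toC t).elim 1 fun a0 => X + C a0

/-- The polynomial `∏_{aᵢ ≠ ∞} (z + aᵢ)` associated to a multiset `a` of points
of `ℝP¹`. -/
noncomputable def fibrePoly (a : Multiset (OnePoint ℝ)) : ℂ[X] := (a.map linFactor).prod

/-- The fibre `X(a)` of the Wronski map over `∏_{aᵢ ≠ ∞} (z + aᵢ)`. -/
def fibre (n : ℕ) (a : Multiset (OnePoint ℝ)) : Set (Submodule ℂ ℂ[X]) :=
  {x | IsGrassPt n x ∧ WrEq n x (fibrePoly a)}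

/-- The total order `⪯` on `ℝP¹` refining `|a| ≤ |b|`:
`a ⪯ b` iff `a = b`, `|a| < |b|`, or `0 < a = -b < ∞`. -/
def ple (x y : OnePoint ℝ) : Prop :=
  x = y ∨ (y = (∞ : OnePoint ℝ) ∧ x ≠ (∞ : OnePoint ℝ)) ∨
    ∃ r s : ℝ, x = (r : OnePoint ℝ) ∧ y = (s : OnePoint ℝ) ∧
      (|r| < |s| ∨ (0 < r ∧ r = -s))

/-- The multiset `{v 1, …, v N}`. -/
def msOfN (N : ℕ) (v : ℕ → OnePoint ℝ) : Multiset (OnePoint ℝ) :=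
  (Finset.Icc 1 N).val.map v

/-- `v 1 ⪯ v 2 ⪯ … ⪯ v N`. -/
def SortedOn (N : ℕ) (v : ℕ → OnePoint ℝ) : Prop :=
  ∀ k l, 1 ≤ k → k ≤ l → l ≤ N → ple (v k) (v l)

/-- The `⪯`-zone of `A` determined by a choice of signs `ε`. -/
def zoneN (N : ℕ) (eps : ℕ → Bool) : Set (ℕ → OnePoint ℝ) :=
  {v | SortedOn N v ∧ ∀ k, 1 ≤ k → k ≤ N →
    (v k = (∞ : OnePoint ℝ) ∨
      ∃ r : ℝ, v k = (r : OnePoint ℝ) ∧ (if eps k then 0 ≤ r else r ≤ 0))}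

/-- The doubled multiset `b⋆ = {b₁, b₁, …, b_M, b_M}`. -/
def starMs (M : ℕ) (v : ℕ → OnePoint ℝ) : Multiset (OnePoint ℝ) :=
  msOfN M v + msOfN M v

/-- The polynomial with coefficient vector `v`. -/
noncomputable def polyOfVec {m : ℕ} (v : Fin m → ℂ) : ℂ[X] :=
  ∑ i, C (v i) * X ^ (i : ℕ)

/-- The topology of the Grassmannian `Gr(n, C_{2n}[z])`: the quotient (coinduced)
topology along the map sending a linearly independent `n`-tuple of coefficient
vectors to its span. -/
noncomputable def grassTop (n : ℕ) : TopologicalSpace (Submodule ℂ ℂ[X]) :=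
  TopologicalSpace.coinduced
    (fun M : {M : Fin n → Fin (2*n+1) → ℂ // LinearIndependent ℂ M} =>
      Submodule.span ℂ (Set.range fun i => polyOfVec (M.1 i)))
    inferInstance

/-- The tangent space at `x` to the Schubert variety `X_λ(a)` (at a point of the
open cell), viewed inside `Hom(x, ℂ[z]/x)`: the maps `φ` with
`φ(x ∩ F_j(a)) ⊆ (F_j(a) + x)/x` for all `j`. -/
def tangentSchubertSet (n : ℕ) (a : Option ℂ) (x : Submodule ℂ ℂ[X]) :
    Set (↥x →ₗ[ℂ] (ℂ[X] ⧸ x)) :=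
  {φ | ∀ j ≤ 2*n+1, ∀ v : x, (v : ℂ[X]) ∈ flag n a j →
      φ v ∈ (flag n a j ⊔ x).map x.mkQ}

/-- The tangent space at an isotropic `x` to the orthogonal Grassmannian `Y`,
inside `Hom(x, ℂ[z]/x)`: the maps `φ` with `⟨φ v, w⟩ + ⟨v, φ w⟩ = 0`. -/
def tangentYSet (n : ℕ) (x : Submodule ℂ ℂ[X]) : Set (↥x →ₗ[ℂ] (ℂ[X] ⧸ x)) :=
  {φ | ∀ v w : x, ∀ pv pw : ℂ[X],
      x.mkQ pv = φ v → x.mkQ pw = φ w →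
      form n pv (w : ℂ[X]) + form n (v : ℂ[X]) pw = 0}

/-- Divisibility of `h` by `(z+a)^k`, where for `a = ∞` this means
`deg h ≤ n(n+1) - k`. -/
def rootMultCond (n : ℕ) (a : Option ℂ) (k : ℕ) (h : ℂ[X]) : Prop :=
  match a with
  | Option.some a0 => (X + C a0)^k ∣ h
  | Option.none => h.natDegree + k ≤ n*(n+1)

/-- The characterizing properties (i)-(v) of the correspondence
`(T, a) ↦ x_T(a)` of Theorem 2.3:
(i) `x_T(a)` lies in the fibre `X(a)`;
(ii) `T ↦ x_T(a)` is surjective onto `X(a)`, and injective when `a` is a set;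
(iii) `a ↦ x_T(a)` is continuous on every `⪯`-zone;
(iv) if `a_i = … = a_j` in the `⪯`-sorted order then `x_T(a) ∈ X_λ(a_i)` where `λ`
is the rectification shape of `T_{[i,j]}`;
(v) under the hypotheses of (iv), if `T_{<i} = T'_{<i}` and `T_{>j} = T'_{>j}` then
`x_T(a) = x_{T'}(a)` iff `T_{[i,j]}` and `T'_{[i,j]}` are dual equivalent. -/
structure CorrProps (n : ℕ)
    (xmap : Filling → Multiset (OnePoint ℝ) → Submodule ℂ ℂ[X]) : Prop where
  mem_fibre : ∀ T a, IsSYTRect n T → Multiset.card a = n*(n+1) →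
    xmap T a ∈ fibre n a
  surj : ∀ a, Multiset.card a = n*(n+1) → ∀ x ∈ fibre n a,
    ∃ T, IsSYTRect n T ∧ xmap T a = x
  inj : ∀ a, Multiset.card a = n*(n+1) → Multiset.Nodup a →
    ∀ T T', IsSYTRect n T → IsSYTRect n T' → xmap T a = xmap T' a → T = T'
  contOn : ∀ T, IsSYTRect n T → ∀ eps : ℕ → Bool,
    @ContinuousOn (ℕ → OnePoint ℝ) (Submodule ℂ ℂ[X]) _ (grassTop n)
      (fun v => xmap T (msOfN (n*(n+1)) v)) (zoneN (n*(n+1)) eps)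
  schub : ∀ v : ℕ → OnePoint ℝ, SortedOn (n*(n+1)) v →
    ∀ i j, 1 ≤ i → i ≤ j → j ≤ n*(n+1) → (∀ k, i ≤ k → k ≤ j → v k = v i) →
    ∀ T, IsSYTRect n T →
    ∀ lam : PartitionIn n, ∀ R : Filling,
      RectifiesTo (subTab T i j) (cellsOf (lowTab T i)) R →
      cellsOf R = partDiag n lam →
      xmap T (msOfN (n*(n+1)) v) ∈ SchubertX n lam (toC (v i))
  dual : ∀ v : ℕ → OnePoint ℝ, SortedOn (n*(n+1)) v →
    ∀ i j, 1 ≤ i → i ≤ j → j ≤ n*(n+1) → (∀ k, i ≤ k → k ≤ j → v k = v i) →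
    ∀ T T', IsSYTRect n T → IsSYTRect n T' →
      lowTab T i = lowTab T' i → highTab T j = highTab T' j →
      (xmap T (msOfN (n*(n+1)) v) = xmap T' (msOfN (n*(n+1)) v) ↔
        DualEquiv (cellsOf (lowTab T i)) (subTab T i j) (subTab T' i j))



/-- order filtration attached to a sequence of functionals -/
def ordGE {V : Type*} [AddCommGroup V] [Module ℂ V] (c : ℕ → V →ₗ[ℂ] ℂ) (m : ℕ) :
    Submodule ℂ V := ⨅ j ∈ Finset.range m, LinearMap.ker (c j)

theorem mem_ordGE {V : Type*} [AddCommGroup V] [Module ℂ V] (c : ℕ → V →ₗ[ℂ] ℂ) (m : ℕ)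
    (p : V) : p ∈ ordGE c m ↔ ∀ j < m, c j p = 0 := by
  simp [ordGE, Submodule.mem_iInf]

theorem finrank_ordGE_succ {V : Type*} [AddCommGroup V] [Module ℂ V] (c : ℕ → V →ₗ[ℂ] ℂ)
    (x : Submodule ℂ V) [FiniteDimensional ℂ x] (m : ℕ) :
    (Module.finrank ℂ ↥(x ⊓ ordGE c m) = Module.finrank ℂ ↥(x ⊓ ordGE c (m+1)) ∧
      ∀ p ∈ x ⊓ ordGE c m, c m p = 0) ∨
    (Module.finrank ℂ ↥(x ⊓ ordGE c m) = Module.finrank ℂ ↥(x ⊓ ordGE c (m+1)) + 1 ∧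
      ∃ p ∈ x ⊓ ordGE c m, c m p ≠ 0) := by
  have hle : x ⊓ ordGE c (m+1) ≤ x ⊓ ordGE c m := by
    refine inf_le_inf_left _ ?_
    intro p hp
    rw [mem_ordGE] at *
    exact fun j hj => hp j (by omega)
  by_cases h : ∀ p ∈ x ⊓ ordGE c m, c m p = 0
  · left
    refine ⟨?_, h⟩
    suffices he : x ⊓ ordGE c m = x ⊓ ordGE c (m+1) by rw [he]
    refine le_antisymm (fun p hp => ⟨hp.1, ?_⟩) hle
    refine (mem_ordGE c _ _).2 ?_
    intro j hj
    rcases Nat.lt_succ_iff_lt_or_eq.1 hj with h1 | rfl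
    · exact (mem_ordGE c m p).1 hp.2 j h1
    · exact h p hp
  · right
    push Not at h
    refine ⟨?_, h⟩
    obtain ⟨p, hp, hpc⟩ := h
    have : FiniteDimensional ℂ ↥(x ⊓ ordGE c m) := Submodule.finiteDimensional_inf_left _ _
    let φ := (c m).comp (x ⊓ ordGE c m).subtype
    have h1 := LinearMap.finrank_range_add_finrank_ker φ
    have h2 : LinearMap.range φ = ⊤ := by
      apply LinearMap.range_eq_top.2
      apply LinearMap.surjective
      intro h0
      exact hpc (by simpa [φ] using congrArg (fun f => f ⟨p, hp⟩) h0)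
    have h3 : (LinearMap.ker φ).map (x ⊓ ordGE c m).subtype = x ⊓ ordGE c (m+1) := by
      ext q
      constructor
      · rintro ⟨⟨q, hq⟩, hk, rfl⟩
        refine ⟨hq.1, ?_⟩
        refine (mem_ordGE c _ _).2 ?_
        intro j hj
        rcases Nat.lt_succ_iff_lt_or_eq.1 hj with h1 | rfl
        · exact (mem_ordGE c m q).1 hq.2 j h1
        · simpa [φ] using hk
      · intro hq
        refine ⟨⟨q, hle hq⟩, ?_, rfl⟩
        have := (mem_ordGE c (m+1) q).1 hq.2 m (by omega)
        simpa [φ] using this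
    have h4 : Module.finrank ℂ ↥(LinearMap.ker φ) = Module.finrank ℂ ↥(x ⊓ ordGE c (m+1)) := by
      rw [← h3]
      exact (LinearEquiv.finrank_eq (Submodule.equivMapOfInjective _
        (Submodule.subtype_injective _) _))
    rw [h2, h4] at h1
    simp at h1
    simp only [Submodule.mem_inf] at *
    omega

theorem echelon {V : Type*} [AddCommGroup V] [Module ℂ V] (c : ℕ → V →ₗ[ℂ] ℂ)
    (x : Submodule ℂ V) [FiniteDimensional ℂ x] (N n : ℕ)
    (hN : ∀ p ∈ x, (∀ j < N, c j p = 0) → p = 0) (hn : Module.finrank ℂ x = n) :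
    ∃ (d : Fin n → ℕ) (g : Fin n → V), StrictMono d ∧ (∀ i, d i < N) ∧ (∀ i, g i ∈ x) ∧
      (∀ i, c (d i) (g i) ≠ 0) ∧ (∀ i, ∀ j < d i, c j (g i) = 0) ∧
      ∀ m, Module.finrank ℂ ↥(x ⊓ ordGE c m) =
        (Finset.univ.filter fun i => m ≤ d i).card := by
  classical
  let D : Finset ℕ := (Finset.range N).filter fun m => ∃ p ∈ x ⊓ ordGE c m, c m p ≠ 0
  have hbig : ∀ m, N ≤ m → Module.finrank ℂ ↥(x ⊓ ordGE c m) = 0 := by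
    intro m hm
    have : x ⊓ ordGE c m = ⊥ := by
      rw [eq_bot_iff]
      intro p hp
      exact hN p hp.1 fun j hj => (mem_ordGE c m p).1 hp.2 j (by omega)
    rw [this]; simp
  have hD : ∀ t m, N ≤ m + t → Module.finrank ℂ ↥(x ⊓ ordGE c m) =
      (D.filter fun i => m ≤ i).card := by
    intro t
    induction t with
    | zero =>
      intro m hm
      rw [hbig m hm, eq_comm, Finset.card_eq_zero, Finset.filter_eq_empty_iff]
      intro i hi
      simp only [D, Finset.mem_filter, Finset.mem_range] at hi
      omega
    | succ t ih =>
      intro m hm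
      by_cases hmN : N ≤ m
      · exact ih m (by omega)
      have h1 := ih (m+1) (by omega)
      rcases finrank_ordGE_succ c x m with ⟨h2, h3⟩ | ⟨h2, h3⟩
      · rw [h2, h1]
        congr 1
        ext i
        simp only [Finset.mem_filter]
        constructor
        · rintro ⟨a, b⟩; exact ⟨a, by omega⟩
        · rintro ⟨a, b⟩
          refine ⟨a, ?_⟩
          rcases Nat.eq_or_lt_of_le b with rfl | hlt
          · simp only [D, Finset.mem_filter] at a
            obtain ⟨p, hp, hpc⟩ := a.2
            exact absurd (h3 p hp) hpc
          · exact hlt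
      · rw [h2, h1]
        have : (D.filter fun i => m ≤ i) = insert m (D.filter fun i => m+1 ≤ i) := by
          ext i
          simp only [Finset.mem_filter, Finset.mem_insert]
          constructor
          · rintro ⟨a, b⟩
            rcases Nat.eq_or_lt_of_le b with rfl | hlt
            · exact Or.inl rfl
            · exact Or.inr ⟨a, hlt⟩
          · rintro (rfl | ⟨a, b⟩)
            · refine ⟨?_, le_rfl⟩
              simp only [D, Finset.mem_filter, Finset.mem_range]
              exact ⟨by omega, h3⟩
            · exact ⟨a, by omega⟩
        rw [this, Finset.card_insert_of_notMem]
        simp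
  have hcard : D.card = n := by
    have := hD N 0 (by omega)
    have h0 : ordGE c 0 = ⊤ := by simp [ordGE]
    rw [h0, inf_top_eq, hn] at this
    simpa using this.symm
  have hmem : ∀ i, D.orderEmbOfFin hcard i ∈ D := fun i => Finset.orderEmbOfFin_mem D hcard i
  have hex : ∀ i, ∃ p ∈ x ⊓ ordGE c (D.orderEmbOfFin hcard i),
      c (D.orderEmbOfFin hcard i) p ≠ 0 := fun i => (Finset.mem_filter.1 (hmem i)).2
  choose g hg hgc using hex
  refine ⟨fun i => D.orderEmbOfFin hcard i, g, (D.orderEmbOfFin hcard).strictMono,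
    fun i => ?_, fun i => (hg i).1, hgc, fun i => (mem_ordGE c _ _).1 (hg i).2, fun m => ?_⟩
  · exact Finset.mem_range.1 (Finset.mem_filter.1 (hmem i)).1
  · rw [hD N m (by omega)]
    rw [← Finset.card_map (D.orderEmbOfFin hcard).toEmbedding]
    congr 1
    ext i
    simp only [Finset.mem_filter, Finset.mem_map, Finset.mem_univ, true_and]
    constructor
    · rintro ⟨a, b⟩
      have : i ∈ Set.range (D.orderEmbOfFin hcard) := by
        rw [Finset.range_orderEmbOfFin]; exact a
      obtain ⟨j, rfl⟩ := this
      exact ⟨j, b, rfl⟩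
    · rintro ⟨j, b, rfl⟩
      exact ⟨hmem j, b⟩

theorem le_card_iff {n : ℕ} (d : Fin n → ℕ) (hd : StrictMono d) (i : ℕ) (hi : i < n) (m : ℕ) :
    i + 1 ≤ (Finset.univ.filter fun j => m ≤ d j).card ↔ m ≤ d (Fin.rev ⟨i, hi⟩) := by
  constructor
  · intro h
    by_contra hlt
    have hsub : (Finset.univ.filter fun j => m ≤ d j) ⊆ Finset.Ioi (Fin.rev ⟨i, hi⟩) := by
      intro j hj
      simp only [Finset.mem_filter, Finset.mem_univ, true_and] at hj
      rw [Finset.mem_Ioi]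
      by_contra hle
      have := hd.monotone (not_lt.1 hle)
      omega
    have := Finset.card_le_card hsub
    rw [Fin.card_Ioi, Fin.val_rev] at this
    simp at this
    omega
  · intro h
    have hsub : Finset.Ici (Fin.rev ⟨i, hi⟩) ⊆ (Finset.univ.filter fun j => m ≤ d j) := by
      intro j hj
      simp only [Finset.mem_filter, Finset.mem_univ, true_and]
      exact h.trans (hd.monotone (Finset.mem_Ici.1 hj))
    have := Finset.card_le_card hsub
    rw [Fin.card_Ici, Fin.val_rev] at this
    simp at this
    omega

theorem det_descPochhammer_ne_zero {n : ℕ} (v : Fin n → ℂ) (hv : Function.Injective v) :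
    (Matrix.of fun i j : Fin n => (descPochhammer ℂ (i : ℕ)).eval (v j)).det ≠ 0 := by
  rw [← Matrix.det_transpose]
  have h := Matrix.det_eval_matrixOfPolynomials_eq_det_vandermonde v
    (fun i : Fin n => descPochhammer ℂ (i : ℕ)) (fun i => descPochhammer_natDegree ℂ _)
    (fun i => monic_descPochhammer ℂ _)
  have h2 : (Matrix.of fun i j : Fin n => (descPochhammer ℂ (i : ℕ)).eval (v j)).transpose =
    Matrix.of (fun i j : Fin n => (descPochhammer ℂ (j : ℕ)).eval (v i)) := rfl
  rw [h2, ← h]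
  exact Matrix.det_vandermonde_ne_zero_iff.2 hv

theorem pow_mul_iter_deriv (a : ℂ) (d : ℕ) (u : ℂ[X]) (i : ℕ) :
    ∃ w : ℂ[X], (X + C a)^i * derivative^[i] ((X + C a)^d * u) = (X + C a)^d * w ∧
      w.eval (-a) = (descPochhammer ℂ i).eval (d : ℂ) * u.eval (-a) := by
  induction i with
  | zero => exact ⟨u, by simp, by simp⟩
  | succ i ih =>
    obtain ⟨w, h1, h2⟩ := ih
    refine ⟨C ((d : ℂ) - i) * w + (X + C a) * derivative w, ?_, ?_⟩
    · rw [Function.iterate_succ_apply']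
      generalize derivative^[i] ((X + C a)^d * u) = q at *
      have h3 := congrArg (fun p => (X + C a) * derivative p) h1
      have hi : ∀ m : ℕ, (X + C a) * derivative ((X + C a : ℂ[X])^m) =
          C (m : ℂ) * (X + C a)^m := by
        intro m
        cases m with
        | zero => simp
        | succ m => rw [derivative_X_add_C_pow]; push_cast; simp; ring
      simp only [derivative_mul] at h3
      have h4 := hi i
      have h5 := hi d
      simp only [map_sub]
      linear_combination h3 - q * h4 + w * h5 + C (i : ℂ) * (-h1)
    · simp [h2, descPochhammer_succ_right]; ring

theorem coeff_X_pow_mul_iter_deriv (g : ℂ[X]) (i m : ℕ) :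
    (X^i * derivative^[i] g).coeff m = (descPochhammer ℂ i).eval (m : ℂ) * g.coeff m := by
  induction i generalizing m with
  | zero => simp
  | succ i ih =>
    rw [Function.iterate_succ_apply']
    generalize derivative^[i] g = q at *
    have hX : ∀ p : ℂ[X], (X * derivative p).coeff m = m * p.coeff m := by
      intro p
      cases m with
      | zero => simp
      | succ m => rw [coeff_X_mul, coeff_derivative]; push_cast; ring
    have h1 : X^(i+1) * derivative q = X * derivative (X^i * q) - C (i : ℂ) * (X^i * q) := by
      cases i with
      | zero => simp
      | succ i => rw [derivative_mul, derivative_X_pow]; push_cast; simp; ring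
    rw [h1, coeff_sub, hX, coeff_C_mul, ih]
    simp [descPochhammer_succ_right]; ring

theorem wr_finite (n : ℕ) (a : ℂ) (d : Fin n → ℕ) (hd : Function.Injective d)
    (u : Fin n → ℂ[X]) (hu : ∀ j, (u j).eval (-a) ≠ 0) :
    ∃ w : ℂ[X], w.eval (-a) ≠ 0 ∧
      (X + C a)^(∑ i : Fin n, (i : ℕ)) * wronskian n (fun j => (X + C a)^(d j) * u j) =
      (X + C a)^(∑ i, d i) * w := by
  choose W hW1 hW2 using fun i j => pow_mul_iter_deriv a (d j) (u j) i
  refine ⟨(Matrix.of fun i j : Fin n => W i j).det, ?_, ?_⟩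
  · rw [← coe_evalRingHom, RingHom.map_det]
    have : (evalRingHom (-a)).mapMatrix (Matrix.of fun i j : Fin n => W i j) =
      Matrix.of fun i j : Fin n => (u j).eval (-a) *
        (Matrix.of fun i j : Fin n => (descPochhammer ℂ (i : ℕ)).eval (d j : ℂ)) i j := by
      ext i j
      simp [hW2, mul_comm]
    rw [this, Matrix.det_mul_row]
    refine mul_ne_zero (Finset.prod_ne_zero_iff.2 fun j _ => hu j)
      (det_descPochhammer_ne_zero _ (Nat.cast_injective.comp hd))
  · rw [← Finset.prod_pow_eq_pow_sum, ← Finset.prod_pow_eq_pow_sum, wronskian,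
      ← Matrix.det_mul_column, ← Matrix.det_mul_row]
    congr 1
    ext1 i j
    exact hW1 i j

theorem wr_infty (n : ℕ) (d : Fin n → ℕ) (hd : Function.Injective d) (hd2 : ∀ j, d j ≤ 2*n)
    (g : Fin n → ℂ[X]) (hg : ∀ j, (g j).coeff (2*n - d j) ≠ 0)
    (hg2 : ∀ j, ∀ m, 2*n - d j < m → (g j).coeff m = 0) :
    wronskian n g ≠ 0 ∧
    (wronskian n g).natDegree + (∑ i : Fin n, (i : ℕ)) + ∑ i, d i = n * (2*n) := by
  let M : Matrix (Fin n) (Fin n) ℂ[X] :=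
    Matrix.of fun i j => X^(d j) * (X^(i : ℕ) * derivative^[(i : ℕ)] (g j))
  have hM : X^(∑ i, d i) * (X^(∑ i : Fin n, (i : ℕ)) * wronskian n g) = M.det := by
    rw [← Finset.prod_pow_eq_pow_sum, ← Finset.prod_pow_eq_pow_sum, wronskian,
      ← Matrix.det_mul_column, ← Matrix.det_mul_row]
    rfl
  have hMd : ∀ i j, (M i j).natDegree ≤ 2*n := by
    intro i j
    rw [natDegree_le_iff_coeff_eq_zero]
    intro N hN
    have := hd2 j
    simp only [M, Matrix.of_apply]
    rw [coeff_X_pow_mul', if_pos (by omega), coeff_X_pow_mul_iter_deriv,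
      hg2 j _ (by omega), mul_zero]
  have hMc : ∀ i j, (M i j).coeff (2*n) = (g j).coeff (2*n - d j) *
      (descPochhammer ℂ (i : ℕ)).eval ((2*n - d j : ℕ) : ℂ) := by
    intro i j
    simp only [M, Matrix.of_apply]
    rw [coeff_X_pow_mul', if_pos (hd2 j), coeff_X_pow_mul_iter_deriv, mul_comm]
  have hdeg : M.det.natDegree ≤ n * (2*n) := by
    rw [Matrix.det_apply]
    refine natDegree_sum_le_of_forall_le _ _ fun σ _ => ?_
    rw [Units.smul_def, zsmul_eq_mul]
    refine (natDegree_mul_le).trans ?_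
    rw [natDegree_intCast, zero_add]
    refine (natDegree_prod_le _ _).trans ?_
    refine (Finset.sum_le_sum fun i _ => hMd (σ i) i).trans ?_
    simp
  have hco : M.det.coeff (n * (2*n)) ≠ 0 := by
    have : M.det.coeff (n*(2*n)) = (Matrix.of fun i j : Fin n => (g j).coeff (2*n - d j) *
        (Matrix.of fun i j : Fin n =>
          (descPochhammer ℂ (i : ℕ)).eval ((2*n - d j : ℕ) : ℂ)) i j).det := by
      rw [Matrix.det_apply, Matrix.det_apply, finsetSum_coeff]
      refine Finset.sum_congr rfl fun σ _ => ?_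
      rw [Units.smul_def, Units.smul_def, coeff_smul]
      congr 1
      have := coeff_prod_of_natDegree_le (s := Finset.univ) (fun i => M (σ i) i) (2*n)
        (fun i _ => hMd _ _)
      rw [Finset.card_univ, Fintype.card_fin] at this
      rw [this]
      refine Finset.prod_congr rfl fun i _ => ?_
      rw [hMc]; rfl
    rw [this, Matrix.det_mul_row]
    refine mul_ne_zero (Finset.prod_ne_zero_iff.2 fun j _ => hg j)
      (det_descPochhammer_ne_zero _ ?_)
    intro i j hij
    have := Nat.cast_injective hij
    have h1 := hd2 i
    have h2 := hd2 j
    exact hd (by omega)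
  have hnd : M.det.natDegree = n * (2*n) := le_antisymm hdeg (le_natDegree_of_ne_zero hco)
  have hW : wronskian n g ≠ 0 := by
    intro h0
    rw [h0, mul_zero, mul_zero] at hM
    rw [← hM] at hco
    simp at hco
  refine ⟨hW, ?_⟩
  rw [← hM, natDegree_mul (by simp) (mul_ne_zero (by simp) hW), natDegree_mul (by simp) hW,
    natDegree_X_pow, natDegree_X_pow] at hnd
  omega

theorem wr_change (n : ℕ) (f g : Fin n → ℂ[X])
    (hg : ∀ j, g j ∈ Submodule.span ℂ (Set.range f)) :
    ∃ b : ℂ, wronskian n g = C b * wronskian n f := by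
  choose B hB using fun j => (Submodule.mem_span_range_iff_exists_fun ℂ).1 (hg j)
  refine ⟨(Matrix.of fun i j => B j i).det, ?_⟩
  rw [mul_comm, RingHom.map_det, wronskian, wronskian, ← Matrix.det_mul]
  congr 1
  ext1 i j
  rw [Matrix.mul_apply]
  simp only [Matrix.of_apply]
  rw [← hB j]
  change derivative^[(i:ℕ)] _ = _
  rw [iterate_derivative_sum]
  refine Finset.sum_congr rfl fun k _ => ?_
  rw [iterate_derivative_smul, smul_eq_C_mul, mul_comm]
  rfl

theorem exists_subpartition (μ : ℕ → ℕ) (n k : ℕ) (h : k ≤ ∑ i ∈ Finset.range n, μ i) :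
    ∃ l : ℕ → ℕ, (∀ i, l i ≤ μ i) ∧ (∀ i, i < n → l (i+1) ≤ μ i → l (i+1) ≤ l i) ∧
      ∑ i ∈ Finset.range n, l i = k := by
  refine ⟨fun i => min (μ i) (k - ∑ j ∈ Finset.range i, μ j), fun i => min_le_left _ _,
    fun i hi h1 => ?_, ?_⟩
  · simp only [Finset.sum_range_succ] at *
    omega
  · have : ∀ m, ∑ i ∈ Finset.range m, min (μ i) (k - ∑ j ∈ Finset.range i, μ j) =
      min (∑ i ∈ Finset.range m, μ i) k := by
      intro m
      induction m with
      | zero => simp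
      | succ m ih => rw [Finset.sum_range_succ, ih, Finset.sum_range_succ]; omega
    rw [this]; omega

theorem partition_core (n : ℕ) (d : Fin n → ℕ) (hd : StrictMono d) (hd2 : ∀ j, d j ≤ 2*n)
    (k : ℕ) : k + ∑ i : Fin n, (i : ℕ) ≤ ∑ i, d i ↔
      ∃ lam : PartitionIn n, wt n lam = k ∧
        ∀ i (hi : i < n), n - 1 - i + lam.part i ≤ d (Fin.rev ⟨i, hi⟩) := by
  have hge : ∀ m (hm : m < n), m ≤ d ⟨m, hm⟩ := by
    intro m
    induction m with
    | zero => intro hm; omega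
    | succ m ih =>
      intro hm
      have h1 := ih (by omega)
      have h2 : d ⟨m, by omega⟩ < d ⟨m+1, hm⟩ := hd (by simp)
      omega
  let μ : ℕ → ℕ := fun i => if h : i < n then d (Fin.rev ⟨i, h⟩) - (n - 1 - i) else 0
  have hμ : ∀ i (hi : i < n), μ i + (n - 1 - i) = d (Fin.rev ⟨i, hi⟩) := by
    intro i hi
    have h1 := hge (n - 1 - i) (by omega)
    have h2 : Fin.rev ⟨i, hi⟩ = ⟨n - 1 - i, by omega⟩ := by
      ext; simp; omega
    simp only [μ, dif_pos hi, h2]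
    omega
  have hrev : ∑ i : Fin n, (n - 1 - (i : ℕ)) = ∑ i : Fin n, (i : ℕ) := by
    rw [← Equiv.sum_comp Fin.revPerm]
    refine Finset.sum_congr rfl fun i _ => ?_
    have := i.2
    simp; omega
  have hdsum : ∑ i : Fin n, d (Fin.rev i) = ∑ i, d i := Equiv.sum_comp Fin.revPerm d
  have hsum : ∑ i ∈ Finset.range n, μ i + ∑ i : Fin n, (i : ℕ) = ∑ i, d i := by
    rw [← hdsum, ← hrev, ← Fin.sum_univ_eq_sum_range, ← Finset.sum_add_distrib]
    exact Finset.sum_congr rfl fun i _ => hμ i i.2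
  have hanti : ∀ i, μ (i+1) ≤ μ i := by
    intro i
    by_cases hi : i + 1 < n
    · have h1 := hμ i (by omega)
      have h2 := hμ (i+1) hi
      have h3 : d (Fin.rev ⟨i+1, hi⟩) < d (Fin.rev ⟨i, by omega⟩) := by
        apply hd
        rw [Fin.rev_lt_rev]
        simp
      omega
    · simp [μ, hi]
  constructor
  · intro h
    obtain ⟨l, hl1, hl2, hl3⟩ := exists_subpartition μ n k (by omega)
    have hz : ∀ i, n ≤ i → l i = 0 := by
      intro i hi
      have := hl1 i
      simp only [μ, dif_neg (not_lt.2 hi)] at this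
      omega
    refine ⟨⟨l, ?_, ?_, hz⟩, hl3, ?_⟩
    · apply antitone_nat_of_succ_le
      intro i
      by_cases hi : i < n
      · exact hl2 i hi ((hl1 _).trans (hanti i))
      · rw [hz (i+1) (by omega)]; omega
    · have h1 := hl1 0
      rcases Nat.eq_zero_or_pos n with h0 | h0
      · rw [hz 0 (by omega)]; omega
      · have h2 := hμ 0 h0
        have h3 := hd2 (Fin.rev ⟨0, h0⟩)
        change l 0 ≤ n + 1
        omega
    · intro i hi
      have h1 := hl1 i
      have h2 := hμ i hi
      change n - 1 - i + l i ≤ _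
      omega
  · rintro ⟨lam, hk, hl⟩
    have : wt n lam ≤ ∑ i ∈ Finset.range n, μ i := by
      refine Finset.sum_le_sum fun i hi => ?_
      have hi := Finset.mem_range.1 hi
      have h1 := hl i hi
      have h2 := hμ i hi
      omega
    omega

theorem schubert_of_functionals (n : ℕ) (x : Submodule ℂ ℂ[X]) (hx : IsGrassPt n x)
    (a : Option ℂ) (c : ℕ → ℂ[X] →ₗ[ℂ] ℂ)
    (hc : ∀ p ∈ degreeLT ℂ (2*n+1), ∀ m ≤ 2*n+1,
      p ∈ flag n a m ↔ ∀ j < 2*n+1-m, c j p = 0)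
    (hc0 : ∀ p ∈ degreeLT ℂ (2*n+1), (∀ j < 2*n+1, c j p = 0) → p = 0) (k : ℕ) :
    ∃ (d : Fin n → ℕ) (g : Fin n → ℂ[X]), StrictMono d ∧ (∀ i, d i ≤ 2*n) ∧ (∀ i, g i ∈ x) ∧
      (∀ i, c (d i) (g i) ≠ 0) ∧ (∀ i, ∀ j < d i, c j (g i) = 0) ∧
      (k + ∑ i : Fin n, (i : ℕ) ≤ ∑ i, d i ↔
        ∃ lam : PartitionIn n, wt n lam = k ∧ x ∈ SchubertX n lam a) := by
  have : FiniteDimensional ℂ x :=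
    Submodule.finiteDimensional_of_le (S₂ := degreeLT ℂ (2*n+1)) hx.1
  obtain ⟨d, g, h1, h2, h3, h4, h5, h6⟩ := echelon c x (2*n+1) n
    (fun p hp => hc0 p (hx.1 hp)) hx.2
  have h2' : ∀ i, d i ≤ 2*n := fun i => Nat.lt_succ_iff.1 (h2 i)
  refine ⟨d, g, h1, h2', h3, h4, h5, ?_⟩
  rw [partition_core n d h1 h2' k]
  refine exists_congr fun lam => and_congr_right fun _ => ?_
  simp only [SchubertX, Set.mem_ofPred_eq, hx, true_and]
  refine forall_congr' fun i => forall_congr' fun hi => ?_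
  have hl : lam.part i ≤ n + 1 := (lam.antitone (Nat.zero_le i)).trans lam.head_le
  have he : x ⊓ flag n a (n + 2 + i - lam.part i) = x ⊓ ordGE c (n - 1 - i + lam.part i) := by
    ext p
    simp only [Submodule.mem_inf]
    refine and_congr_right fun hp => ?_
    rw [mem_ordGE, hc p (hx.1 hp) _ (by omega)]
    rw [show 2*n+1 - (n + 2 + i - lam.part i) = n - 1 - i + lam.part i by omega]
  rw [he, h6, le_card_iff d h1 i hi]

theorem pow_dvd_iff_taylor (a : ℂ) (m : ℕ) (p : ℂ[X]) :
    (X + C a)^m ∣ p ↔ ∀ j < m, (taylor (-a) p).coeff j = 0 := by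
  rw [← X_pow_dvd_iff, ← map_dvd_iff (taylorEquiv (-a))]
  have : taylorEquiv (-a) ((X + C a)^m) = X^m := by
    change taylor (-a) ((X + C a)^m) = X^m
    simp
  rw [this]
  rfl

/-- **Proposition 2.1.** `Wr(x;z)` is divisible by `(z+a)^k` if and only if
`x ∈ X_λ(a)` for some partition `λ ⊢ k`. -/
theorem wronskian_divisible_iff_schubert (n : ℕ) (x : Submodule ℂ ℂ[X])
    (hx : IsGrassPt n x) (h : ℂ[X]) (hw : WrEq n x h) (a : Option ℂ) (k : ℕ) :
    rootMultCond n a k h ↔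
      ∃ lam : PartitionIn n, wt n lam = k ∧ x ∈ SchubertX n lam a := by
  obtain ⟨f, hf, c0, hc0, hfh⟩ := hw
  -- comparison of any tuple in `x` having nonzero Wronskian with `h`
  have hcomp : ∀ g : Fin n → ℂ[X], (∀ i, g i ∈ x) → wronskian n g ≠ 0 →
      ∃ b : ℂ, b ≠ 0 ∧ wronskian n g = C b * h := by
    intro g hg hne
    obtain ⟨b, hb⟩ := wr_change n f g (fun j => hf ▸ hg j)
    rw [hfh, smul_eq_C_mul, ← mul_assoc, ← C_mul] at hb
    refine ⟨b * c0, ?_, hb⟩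
    rintro h0
    rw [h0] at hb
    exact hne (by simpa using hb)
  cases a with
  | none =>
    obtain ⟨d, g, h1, h2, h3, h4, h5, h6⟩ := schubert_of_functionals n x hx none
      (fun j => if j ≤ 2*n then lcoeff ℂ (2*n - j) else 0)
      (by
        intro p hp m hm
        change p ∈ degreeLT ℂ m ↔ _
        rw [mem_degreeLT, degree_lt_iff_coeff_zero] at *
        constructor
        · intro hq j hj
          rw [if_pos (by omega)]
          exact hq _ (by omega)
        · intro hq j hj
          by_cases hj2 : j ≤ 2*n
          · have := hq (2*n - j) (by omega)
            rw [if_pos (by omega)] at this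
            rw [← this, lcoeff_apply]
            congr 1
            omega
          · exact hp j (by omega))
      (by
        intro p hp hq
        rw [mem_degreeLT, degree_lt_iff_coeff_zero] at hp
        ext j
        by_cases hj2 : j ≤ 2*n
        · have := hq (2*n - j) (by omega)
          rw [if_pos (by omega), lcoeff_apply] at this
          rw [coeff_zero, ← this]
          congr 1
          omega
        · exact hp j (by omega)) k
    rw [← h6]
    have h4' : ∀ j, (g j).coeff (2*n - d j) ≠ 0 := by
      intro j
      have := h4 j
      rwa [if_pos (h2 j), lcoeff_apply] at this
    have h5' : ∀ j, ∀ m, 2*n - d j < m → (g j).coeff m = 0 := by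
      intro j m hm
      have hp := hx.1 (h3 j)
      rw [mem_degreeLT, degree_lt_iff_coeff_zero] at hp
      by_cases hm2 : m ≤ 2*n
      · have := h5 j (2*n - m) (by omega)
        rw [if_pos (by omega), lcoeff_apply] at this
        rw [← this]
        congr 1
        omega
      · exact hp m (by omega)
    obtain ⟨hne, hdeg⟩ := wr_infty n d h1.injective h2 g h4' h5'
    obtain ⟨b, hb, hbh⟩ := hcomp g h3 hne
    rw [hbh, natDegree_C_mul hb] at hdeg
    change h.natDegree + k ≤ n*(n+1) ↔ _
    have hG : (∑ i : Fin n, (i : ℕ)) * 2 + n = n * n := by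
      rw [Fin.sum_univ_eq_sum_range (fun i => i), Finset.sum_range_id_mul_two]
      cases n with
      | zero => rfl
      | succ n => simp; ring
    have e1 : n * (n+1) = n*n + n := by ring
    have e2 : n * (2*n) = n*n + n*n := by ring
    omega
  | some a =>
    obtain ⟨d, g, h1, h2, h3, h4, h5, h6⟩ := schubert_of_functionals n x hx (Option.some a)
      (fun j => (lcoeff ℂ j).comp (taylor (-a)))
      (by
        intro p hp m hm
        change (p ∈ degreeLT ℂ (2*n+1) ∧ (X + C a)^(2*n+1-m) ∣ p) ↔ _
        rw [pow_dvd_iff_taylor]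
        simp [hp])
      (by
        intro p hp hq
        have hdvd : (X + C a)^(2*n+1) ∣ p := by
          rw [pow_dvd_iff_taylor]
          exact hq
        rw [mem_degreeLT] at hp
        refine eq_zero_of_dvd_of_degree_lt hdvd ?_
        rw [degree_pow, degree_X_add_C]
        simpa using hp) k
    rw [← h6]
    choose u hu using fun j => (pow_dvd_iff_taylor a (d j) (g j)).2 (h5 j)
    have hu0 : ∀ j, (u j).eval (-a) ≠ 0 := by
      intro j
      have := h4 j
      rw [LinearMap.comp_apply, lcoeff_apply, hu j, taylor_mul] at this
      have e : taylor (-a) ((X + C a)^(d j)) = X^(d j) := by simp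
      rw [e, coeff_X_pow_mul', if_pos le_rfl, Nat.sub_self, taylor_coeff_zero] at this
      exact this
    obtain ⟨w, hw, hwr⟩ := wr_finite n a d h1.injective u hu0
    have hgu : (fun j => (X + C a)^(d j) * u j) = g := by
      funext j; exact (hu j).symm
    rw [hgu] at hwr
    have hL : (X + C a : ℂ[X]) ≠ 0 := X_add_C_ne_zero a
    have hw0 : w ≠ 0 := by rintro rfl; simp at hw
    have hne : wronskian n g ≠ 0 := by
      intro h0
      rw [h0, mul_zero] at hwr
      exact mul_ne_zero (pow_ne_zero _ hL) hw0 hwr.symm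
    obtain ⟨b, hb, hbh⟩ := hcomp g h3 hne
    change (X + C a)^k ∣ h ↔ _
    have hbu : IsUnit (C b : ℂ[X]) := isUnit_C.2 hb.isUnit
    rw [← hbu.dvd_mul_left, ← hbh, ← mul_dvd_mul_iff_left (pow_ne_zero (∑ i : Fin n, (i : ℕ)) hL),
      hwr, ← pow_add]
    constructor
    · intro hd
      by_contra hlt
      rw [add_comm k] at hlt
      obtain ⟨t, ht⟩ := Nat.exists_eq_add_of_lt (not_le.1 hlt)
      rw [ht, add_assoc, pow_add, mul_dvd_mul_iff_left (pow_ne_zero _ hL), pow_succ] at hd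
      obtain ⟨q, rfl⟩ := (dvd_mul_left _ _).trans hd
      simp at hw
    · intro hle
      exact (pow_dvd_pow _ (by omega)).mul_right _

end OG
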